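/- Assume the Riemann Hypothesis. Let M′ ≥ 1 be a real number and let x > 0 be a real number. Then the sum over the nontrivial zeros ρ of the Riemann zeta function with positive imaginary part of the terms x^ρ · ζ(ρ − M′) / ρ diverges; precisely, the function ρ ↦ x^ρ · ζ(ρ − M′) / ρ, defined on the set {ρ ∈ ℂ : ζ(ρ) = 0, 0 < Re(ρ) < 1, Im(ρ) > 0}, is not summable. -/

import Mathlib

open Complex

/-- The derivative of an entire function of subquadratic growth is constant. -/
theorem deriv_eq_deriv_zero_of_norm_le_rpow {g : ℂ → ℂ} (hg : Differentiable ℂ g) {p A B : ℝ}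
    (hp : p < 2) (hp₀ : 0 ≤ p) (hB : 0 ≤ B) (hbound : ∀ z, ‖g z‖ ≤ A + B * (1 + ‖z‖) ^ p) (z : ℂ) :
    deriv g z = deriv g 0 := by
  refine is_const_of_deriv_eq_zero hg.deriv (fun c => ?_) z 0
  have hit : deriv (deriv g) c = iteratedDeriv 2 g c := by
    rw [iteratedDeriv_succ, iteratedDeriv_one]
  rw [hit, ← norm_le_zero_iff]
  have hlim : Filter.Tendsto
      (fun R : ℝ => 2 * (A / R ^ 2 + B * (2 ^ p * R ^ (-(2 - p))))) Filter.atTop (nhds 0) := by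
    have h1 : Filter.Tendsto (fun R : ℝ => A / R ^ 2) Filter.atTop (nhds 0) :=
      tendsto_const_nhds.div_atTop (Filter.tendsto_pow_atTop two_ne_zero)
    have h2 := tendsto_rpow_neg_atTop (y := 2 - p) (by linarith)
    simpa using (h1.add ((h2.const_mul (2 ^ p)).const_mul B)).const_mul 2
  refine ge_of_tendsto hlim ?_
  filter_upwards [Filter.eventually_ge_atTop (1 + ‖c‖)] with R hR
  have hR0 : 0 < R := by linarith [norm_nonneg c]
  have := norm_iteratedDeriv_le_of_forall_mem_sphere_norm_le (c := c) (R := R)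
    (C := A + B * (2 * R) ^ p) 2 hR0 hg.diffContOnCl (fun w hw => (hbound w).trans ?_)
  · refine this.trans_eq ?_
    rw [Real.mul_rpow zero_le_two hR0.le, neg_sub, Real.rpow_sub hR0, Real.rpow_two]
    simp [Nat.factorial]
    field_simp
  · have hw' : ‖w‖ ≤ ‖c‖ + R := by
      have := norm_add_le c (w - c)
      rw [mem_sphere_iff_norm] at hw
      simpa [hw] using this
    gcongr
    linarith

/-- An entire function without zeros is the exponential of an entire function. -/
theorem exists_differentiable_eq_exp {F : ℂ → ℂ} (hF : Differentiable ℂ F) (h0 : ∀ z, F z ≠ 0) :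
    ∃ g : ℂ → ℂ, Differentiable ℂ g ∧ ∀ z, F z = exp (g z) := by
  obtain ⟨g, hg0, hg⟩ :=
    ((hF.deriv.div hF h0).isExactOn_univ).with_val_at 0 (log (F 0))
  have hg' : ∀ z, HasDerivAt g (deriv F z / F z) z := fun z => hg z (Set.mem_univ z)
  have hd : ∀ z, HasDerivAt (fun z => F z * exp (-g z)) 0 z := fun z => by
    refine ((hF z).hasDerivAt.mul (hg' z).neg.cexp).congr_deriv ?_
    rw [mul_neg, mul_neg, mul_left_comm, mul_div_cancel₀ _ (h0 z), Pi.neg_apply]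
    ring
  refine ⟨g, fun z => (hg' z).differentiableAt, fun z => ?_⟩
  have := is_const_of_deriv_eq_zero (fun z => (hd z).differentiableAt) (fun z => (hd z).deriv) z 0
  simp only [hg0, exp_neg, exp_log (h0 0), mul_inv_cancel₀ (h0 0)] at this
  field_simp at this
  exact this

theorem exists_norm_le_exp_of_forall_ne_zero {F : ℂ → ℂ} (hF : Differentiable ℂ F)
    (h0 : ∀ z, F z ≠ 0) {p K C : ℝ} (hp₀ : 0 ≤ p) (hp : p < 2) (hC : 0 ≤ C)
    (hbound : ∀ z, ‖F z‖ ≤ K * Real.exp (C * (1 + ‖z‖) ^ p)) :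
    ∃ K' A : ℝ, 0 ≤ A ∧ ∀ z, ‖F z‖ ≤ K' * Real.exp (A * ‖z‖) := by
  obtain ⟨g, hg, hFg⟩ := exists_differentiable_eq_exp hF h0
  have hK : 0 < K := by
    have := (norm_pos_iff.2 (h0 0)).trans_le (hbound 0)
    exact pos_of_mul_pos_left this (Real.exp_nonneg _)
  have hre : ∀ z, (g z).re ≤ Real.log K + C * (1 + ‖z‖) ^ p := fun z => by
    have := hbound z
    rw [hFg, norm_exp, ← Real.exp_log hK, ← Real.exp_add, Real.exp_le_exp] at this
    simpa using this
  have hgb : ∀ z, ‖g z‖ ≤ (2 * (|Real.log K| + 1) + 3 * ‖g 0‖) +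
      (2 * C * 2 ^ p) * (1 + ‖z‖) ^ p := fun z => by
    have hz := norm_nonneg z
    set M := |Real.log K| + 1 + C * (2 * (1 + ‖z‖)) ^ p with hM
    have hM0 : 0 < M := by positivity
    have := borelCaratheodory (f := g) (M := M) (R := 2 * ‖z‖ + 1) (z := z) hM0
      hg.differentiableOn (fun w hw => ?_) (by positivity) (by simp; linarith)
    · refine this.trans ?_
      have h1 : 2 * M * ‖z‖ / (2 * ‖z‖ + 1 - ‖z‖) ≤ 2 * M := by
        rw [div_le_iff₀ (by linarith)]; nlinarith
      have h2 : ‖g 0‖ * (2 * ‖z‖ + 1 + ‖z‖) / (2 * ‖z‖ + 1 - ‖z‖) ≤ 3 * ‖g 0‖ := by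
        rw [div_le_iff₀ (by linarith)]; nlinarith [norm_nonneg (g 0)]
      rw [Real.mul_rpow zero_le_two (by linarith)] at hM
      have h3 : 2 * M = 2 * (|Real.log K| + 1) + 2 * C * 2 ^ p * (1 + ‖z‖) ^ p := by
        rw [hM]; ring
      linarith
    · have hw' : ‖w‖ < 2 * ‖z‖ + 1 := by simpa using hw
      refine (hre w).trans ?_
      have : (1 + ‖w‖) ^ p ≤ (2 * (1 + ‖z‖)) ^ p := by gcongr; linarith
      have := mul_le_mul_of_nonneg_left this hC
      linarith [le_abs_self (Real.log K)]
  have hderiv := deriv_eq_deriv_zero_of_norm_le_rpow hg hp hp₀ (by positivity) hgb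
  have hlin : ∀ z, g z = g 0 + deriv g 0 * z := fun z => by
    have hd : ∀ w, HasDerivAt (fun w => g w - deriv g 0 * w) 0 w := fun w => by
      refine ((hg w).hasDerivAt.sub ((hasDerivAt_id w).const_mul (deriv g 0))).congr_deriv ?_
      simp [hderiv w]
    have := is_const_of_deriv_eq_zero (fun z => (hd z).differentiableAt)
      (fun z => (hd z).deriv) z 0
    simp only [mul_zero, sub_zero] at this
    linear_combination this
  refine ⟨Real.exp ‖g 0‖, ‖deriv g 0‖, norm_nonneg _, fun z => ?_⟩
  rw [hFg, norm_exp, ← Real.exp_add, Real.exp_le_exp, hlin, ← norm_mul]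
  exact (re_le_norm _).trans (norm_add_le _ _)

/-- A zero of an entire function that does not vanish identically can be divided out. -/
theorem exists_eq_pow_mul_of_not_eventually_zero {F : ℂ → ℂ} (hF : Differentiable ℂ F) (r : ℂ)
    (hr : ¬ ∀ᶠ z in nhds r, F z = 0) :
    ∃ (n : ℕ) (G : ℂ → ℂ), Differentiable ℂ G ∧ G r ≠ 0 ∧ ∀ z, F z = (z - r) ^ n * G z := by
  obtain ⟨n, g, hg, hgr, hFg⟩ :=
    (hF.analyticAt r).exists_eventuallyEq_pow_smul_nonzero_iff.2 hr
  classical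
  let G := Function.update (fun z => F z / (z - r) ^ n) r (g r)
  have hGr : G r = g r := Function.update_self ..
  have hGz : ∀ z, z ≠ r → G z = F z / (z - r) ^ n := fun z hz => Function.update_of_ne hz ..
  refine ⟨n, G, fun z => ?_, hGr ▸ hgr, fun z => ?_⟩
  · rcases eq_or_ne z r with rfl | hz
    · refine hg.differentiableAt.congr_of_eventuallyEq ?_
      filter_upwards [hFg] with w hw
      rcases eq_or_ne w z with rfl | hwz
      · exact hGr
      · rw [hGz w hwz, hw, smul_eq_mul, mul_div_cancel_left₀ _ (pow_ne_zero _ (sub_ne_zero.2 hwz))]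
    · have : DifferentiableAt ℂ (fun z => F z / (z - r) ^ n) z :=
        (hF z).div (by fun_prop) (pow_ne_zero _ (sub_ne_zero.2 hz))
      refine this.congr_of_eventuallyEq ?_
      filter_upwards [isOpen_ne.mem_nhds hz] with w hw using hGz w hw
  · rcases eq_or_ne z r with rfl | hz
    · rw [hFg.self_of_nhds, hGr, smul_eq_mul]
    · rw [hGz z hz, mul_div_cancel₀ _ (pow_ne_zero _ (sub_ne_zero.2 hz))]

/-- An entire function of order less than two with finitely many zeros is of exponential type. -/
theorem exists_norm_le_exp_of_finite_zeros {p : ℝ} (hp₀ : 0 ≤ p) (hp : p < 2) {F : ℂ → ℂ}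
    (hF : Differentiable ℂ F) (hfin : {z | F z = 0}.Finite) {K C : ℝ} (hC : 0 ≤ C)
    (hbound : ∀ z, ‖F z‖ ≤ K * Real.exp (C * (1 + ‖z‖) ^ p)) :
    ∃ K' A : ℝ, 0 ≤ A ∧ ∀ z, ‖F z‖ ≤ K' * Real.exp (A * ‖z‖) := by
  suffices h : ∀ (S : Finset ℂ) (F : ℂ → ℂ) (K : ℝ), Differentiable ℂ F → {z | F z = 0} ⊆ S →
      (∀ z, ‖F z‖ ≤ K * Real.exp (C * (1 + ‖z‖) ^ p)) →
      ∃ K' A : ℝ, 0 ≤ A ∧ ∀ z, ‖F z‖ ≤ K' * Real.exp (A * ‖z‖) from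
    h hfin.toFinset F K hF (by simp) hbound
  clear! F K
  intro S
  induction S using Finset.induction_on with
  | empty =>
    intro F K hF hS hbound
    refine exists_norm_le_exp_of_forall_ne_zero hF (fun z hz => ?_) hp₀ hp hC hbound
    simpa using hS hz
  | insert r S _ ih =>
    intro F K hF hS hbound
    have hr : ¬ ∀ᶠ z in nhds r, F z = 0 := fun h =>
      infinite_of_mem_nhds r h ((Finset.finite_toSet _).subset hS)
    obtain ⟨n, G, hG, hGr, hFG⟩ := exists_eq_pow_mul_of_not_eventually_zero hF r hr
    obtain ⟨B, hB⟩ := (isCompact_closedBall r 1).exists_bound_of_continuousOn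
      hG.continuous.continuousOn
    have hK : 0 ≤ K := nonneg_of_mul_nonneg_left ((norm_nonneg _).trans (hbound 0))
      (Real.exp_pos _)
    have hGS : {z | G z = 0} ⊆ S := fun z hz => by
      have hGz : G z = 0 := hz
      have hzF := hS (show F z = 0 by rw [hFG, hGz, mul_zero])
      have hzr : z ≠ r := by rintro rfl; exact hGr hz
      simpa [hzr] using hzF
    have hGbound : ∀ z, ‖G z‖ ≤ max K B * Real.exp (C * (1 + ‖z‖) ^ p) := fun z => by
      have he : 1 ≤ Real.exp (C * (1 + ‖z‖) ^ p) := Real.one_le_exp (by positivity)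
      rcases le_total ‖z - r‖ 1 with h | h
      · calc ‖G z‖ ≤ max K B := (hB z (by simpa [dist_eq_norm] using h)).trans (le_max_right _ _)
          _ ≤ _ := le_mul_of_one_le_right (hK.trans (le_max_left _ _)) he
      · calc ‖G z‖ ≤ ‖z - r‖ ^ n * ‖G z‖ :=
              le_mul_of_one_le_left (norm_nonneg _) (one_le_pow₀ h)
          _ = ‖F z‖ := by rw [hFG, norm_mul, norm_pow]
          _ ≤ _ := (hbound z).trans (by gcongr; exact le_max_left _ _)
    obtain ⟨K', A, hA, hGA⟩ := ih G (max K B) hG hGS hGbound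
    refine ⟨Real.exp (n * ‖r‖) * K', n + A, by positivity, fun z => ?_⟩
    have h1 : ‖z - r‖ ^ n ≤ Real.exp (n * ‖r‖) * Real.exp (n * ‖z‖) := by
      rw [← Real.exp_add, ← mul_add, Real.exp_nat_mul]
      gcongr
      linarith [norm_sub_le z r, Real.add_one_le_exp (‖r‖ + ‖z‖)]
    calc ‖F z‖ = ‖z - r‖ ^ n * ‖G z‖ := by rw [hFG, norm_mul, norm_pow]
      _ ≤ (Real.exp (n * ‖r‖) * Real.exp (n * ‖z‖)) * (K' * Real.exp (A * ‖z‖)) := by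
        gcongr; exact hGA z
      _ = _ := by rw [add_mul, Real.exp_add]; ring

theorem norm_Gamma_le_Gamma_re {s : ℂ} (hs : 0 < s.re) : ‖Gamma s‖ ≤ Real.Gamma s.re := by
  rw [Gamma_eq_integral hs, GammaIntegral, Real.Gamma_eq_integral hs]
  refine (MeasureTheory.norm_integral_le_integral_norm _).trans_eq ?_
  refine MeasureTheory.setIntegral_congr_fun measurableSet_Ioi fun x hx => ?_
  simp only [norm_mul, norm_cpow_eq_rpow_re_of_pos hx, norm_real, Real.norm_eq_abs, Real.abs_exp,
    sub_re, one_re]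

theorem Gamma_le_rpow_self {x : ℝ} (hx : 2 ≤ x) : Real.Gamma x ≤ x ^ x := by
  have hm : (⌊x⌋₊ : ℝ) ≤ x := Nat.floor_le (by linarith)
  have h1 : x ≤ ⌊x⌋₊ + 1 := (Nat.lt_floor_add_one x).le
  calc Real.Gamma x ≤ Real.Gamma (⌊x⌋₊ + 1) :=
        Real.Gamma_strictMonoOn_Ici.monotoneOn hx (hx.trans h1) h1
    _ = (⌊x⌋₊.factorial : ℝ) := Real.Gamma_nat_eq_factorial _
    _ ≤ (⌊x⌋₊ : ℝ) ^ ⌊x⌋₊ := by exact_mod_cast Nat.factorial_le_pow _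
    _ ≤ x ^ ⌊x⌋₊ := by gcongr
    _ = x ^ (⌊x⌋₊ : ℝ) := (Real.rpow_natCast _ _).symm
    _ ≤ x ^ x := Real.rpow_le_rpow_of_exponent_le (by linarith) hm

theorem rpow_self_le_exp {x : ℝ} (hx : 0 < x) : x ^ x ≤ Real.exp (2 * x ^ (3 / 2 : ℝ)) := by
  rw [Real.rpow_def_of_pos hx, Real.exp_le_exp]
  have h := Real.log_le_rpow_div hx.le (ε := 1 / 2) (by norm_num)
  have h2 : x ^ (3 / 2 : ℝ) = x * x ^ (1 / 2 : ℝ) := by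
    rw [← Real.rpow_one_add' hx.le (by norm_num)]; norm_num
  rw [h2]
  nlinarith

/-- An upper bound for Dirichlet series in a half-plane of absolute convergence. -/
theorem norm_LSeries_le_tsum {f : ℕ → ℂ} {σ : ℝ} (hf : LSeriesSummable f σ) {s : ℂ}
    (hs : σ ≤ s.re) : ‖LSeries f s‖ ≤ ∑' n, ‖LSeries.term f σ n‖ :=
  tsum_of_norm_bounded hf.norm.hasSum fun n => LSeries.norm_term_le_of_re_le_re f (by simpa) n

theorem exists_norm_riemannZeta_le {σ : ℝ} (hσ : 1 < σ) :
    ∃ K : ℝ, 0 ≤ K ∧ ∀ s : ℂ, σ ≤ s.re → ‖riemannZeta s‖ ≤ K := by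
  refine ⟨∑' n, ‖LSeries.term 1 (σ : ℂ) n‖, tsum_nonneg fun _ => norm_nonneg _, fun s hs => ?_⟩
  rw [← LSeries_one_eq_riemannZeta (hσ.trans_le hs)]
  exact norm_LSeries_le_tsum (LSeriesSummable_one_iff.2 (by simpa)) hs

theorem exists_le_norm_riemannZeta {σ : ℝ} (hσ : 1 < σ) :
    ∃ c : ℝ, 0 < c ∧ ∀ s : ℂ, σ ≤ s.re → c ≤ ‖riemannZeta s‖ := by
  set f : ℕ → ℂ := fun n => (ArithmeticFunction.moebius n : ℂ)
  set K := ∑' n, ‖LSeries.term f (σ : ℂ) n‖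
  have hK : 0 ≤ K := tsum_nonneg fun _ => norm_nonneg _
  refine ⟨(K + 1)⁻¹, by positivity, fun s hs => ?_⟩
  have hb : ‖LSeries f s‖ ≤ K :=
    norm_LSeries_le_tsum (ArithmeticFunction.LSeriesSummable_moebius_iff.2 (by simpa)) hs
  have h1 := congrArg norm (LSeries_one_mul_Lseries_moebius (hσ.trans_le hs))
  rw [LSeries_one_eq_riemannZeta (hσ.trans_le hs), norm_mul, norm_one] at h1
  rw [inv_le_iff_one_le_mul₀ (by positivity)]
  calc (1 : ℝ) = ‖riemannZeta s‖ * ‖LSeries f s‖ := h1.symm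
    _ ≤ ‖riemannZeta s‖ * (K + 1) := by gcongr; linarith

/-- A Mellin transform is bounded on vertical strips in which it converges absolutely. -/
theorem exists_norm_mellin_le {f : ℝ → ℂ} {a b : ℝ} (ha : MellinConvergent f a)
    (hb : MellinConvergent f b) :
    ∃ B : ℝ, ∀ s : ℂ, a ≤ s.re → s.re ≤ b → ‖mellin f s‖ ≤ B := by
  refine ⟨∫ t in Set.Ioi (0 : ℝ), (‖(t : ℂ) ^ ((a : ℂ) - 1) • f t‖ + ‖(t : ℂ) ^ ((b : ℂ) - 1) • f t‖),
    fun s has hsb => ?_⟩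
  refine MeasureTheory.norm_integral_le_of_norm_le (ha.norm.add hb.norm) ?_
  refine (MeasureTheory.ae_restrict_iff' measurableSet_Ioi).2 (Filter.Eventually.of_forall ?_)
  intro t (ht : 0 < t)
  simp only [norm_smul, norm_cpow_eq_rpow_re_of_pos ht, sub_re, ofReal_re, one_re, ← add_mul]
  gcongr
  rcases le_total t 1 with h | h
  · have := Real.rpow_le_rpow_of_exponent_ge ht h (sub_le_sub_right has 1)
    have := Real.rpow_nonneg ht.le (b - 1)
    linarith
  · have := Real.rpow_le_rpow_of_exponent_le h (sub_le_sub_right hsb 1)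
    have := Real.rpow_nonneg ht.le (a - 1)
    linarith

theorem exists_norm_completedRiemannZeta₀_le (a b : ℝ) :
    ∃ B : ℝ, ∀ s : ℂ, a ≤ s.re → s.re ≤ b → ‖completedRiemannZeta₀ s‖ ≤ B := by
  have hconv (s : ℂ) : MellinConvergent (HurwitzZeta.hurwitzEvenFEPair 0).f_modif s :=
    ((HurwitzZeta.hurwitzEvenFEPair 0).isStrongFEPair_toStrongFEPair.hasMellin s).1
  obtain ⟨B, hB⟩ := exists_norm_mellin_le (hconv (a / 2 : ℝ)) (hconv (b / 2 : ℝ))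
  refine ⟨B / 2, fun s has hsb => ?_⟩
  have : (s / 2).re = s.re / 2 := by simp
  have := hB (s / 2) (by linarith) (by linarith)
  change ‖mellin (HurwitzZeta.hurwitzEvenFEPair 0).f_modif (s / 2) / 2‖ ≤ B / 2
  rw [norm_div, norm_ofNat]
  gcongr

theorem norm_Gammaℝ_of_re (s : ℂ) :
    ‖Gammaℝ s‖ = Real.pi ^ (-s.re / 2) * ‖Gamma (s / 2)‖ := by
  rw [Gammaℝ_def, norm_mul, norm_cpow_eq_rpow_re_of_pos Real.pi_pos]
  simp

theorem completedRiemannZeta_eq_Gammaℝ_mul {s : ℂ} (hs : 1 ≤ s.re) :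
    completedRiemannZeta s = Gammaℝ s * riemannZeta s := by
  rw [riemannZeta_def_of_ne_zero (by rintro rfl; norm_num at hs),
    mul_div_cancel₀ _ (Gammaℝ_ne_zero_of_re_pos (by linarith))]

/-- The entire function `s * (s - 1) * completedRiemannZeta s`. -/
noncomputable def entireXi (s : ℂ) : ℂ := s * (s - 1) * completedRiemannZeta₀ s + 1

theorem differentiable_entireXi : Differentiable ℂ entireXi :=
  ((differentiable_id.mul (differentiable_id.sub_const 1)).mul
    differentiable_completedZeta₀).add_const 1

theorem entireXi_one_sub (s : ℂ) : entireXi (1 - s) = entireXi s := by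
  simp only [entireXi, completedRiemannZeta₀_one_sub]
  ring

theorem entireXi_eq {s : ℂ} (h0 : s ≠ 0) (h1 : s ≠ 1) :
    entireXi s = s * (s - 1) * completedRiemannZeta s := by
  have h1' : 1 - s ≠ 0 := sub_ne_zero.2 h1.symm
  rw [entireXi, completedRiemannZeta_eq]
  field_simp
  ring

theorem nontrivial_zero_of_entireXi_eq_zero {s : ℂ} (hs : entireXi s = 0) :
    riemannZeta s = 0 ∧ 0 < s.re ∧ s.re < 1 := by
  have key : ∀ {s : ℂ}, entireXi s = 0 → riemannZeta s = 0 := fun {s} hs => by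
    have h0 : s ≠ 0 := by rintro rfl; simp [entireXi] at hs
    have h1 : s ≠ 1 := by rintro rfl; simp [entireXi] at hs
    rw [entireXi_eq h0 h1] at hs
    have : completedRiemannZeta s = 0 := by simpa [h0, sub_ne_zero.2 h1] using hs
    rw [riemannZeta_def_of_ne_zero h0, this, zero_div]
  have key' : ∀ {s : ℂ}, entireXi s = 0 → s.re < 1 := fun {s} hs => by
    by_contra! h
    exact riemannZeta_ne_zero_of_one_le_re h (key hs)
  refine ⟨key hs, ?_, key' hs⟩
  have := key' (s := 1 - s) (by rwa [entireXi_one_sub])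
  simpa using this

theorem exists_norm_entireXi_le_exp :
    ∃ K : ℝ, ∀ s, ‖entireXi s‖ ≤ K * Real.exp (16 * (1 + ‖s‖) ^ (3 / 2 : ℝ)) := by
  obtain ⟨Z, hZ0, hZ⟩ := exists_norm_riemannZeta_le (σ := 4) (by norm_num)
  obtain ⟨B, hB⟩ := exists_norm_completedRiemannZeta₀_le (-3) 4
  have hself : ∀ {x : ℝ}, 1 ≤ x → x ≤ x ^ (3 / 2 : ℝ) := fun {x} hx => by
    simpa using Real.rpow_le_rpow_of_exponent_le hx (show (1 : ℝ) ≤ 3 / 2 by norm_num)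
  have hsq : ∀ s : ℂ, ‖s * (s - 1)‖ ≤ Real.exp (2 * (1 + ‖s‖) ^ (3 / 2 : ℝ)) := fun s => by
    have hs := norm_nonneg s
    have h1 : 1 + ‖s‖ ≤ Real.exp ((1 + ‖s‖) ^ (3 / 2 : ℝ)) :=
      (hself (by linarith)).trans (by linarith [Real.add_one_le_exp ((1 + ‖s‖) ^ (3 / 2 : ℝ))])
    have h2 : ‖s - 1‖ ≤ 1 + ‖s‖ := by simpa [add_comm] using norm_sub_le s 1
    rw [norm_mul, two_mul, Real.exp_add]
    gcongr
    · linarith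
    · linarith
  have hright : ∀ s : ℂ, 4 ≤ s.re →
      ‖entireXi s‖ ≤ Z * Real.exp (4 * (1 + ‖s‖) ^ (3 / 2 : ℝ)) := fun s hs => by
    have h0 : s ≠ 0 := by rintro rfl; norm_num at hs
    have h1 : s ≠ 1 := by rintro rfl; norm_num at hs
    have hre : (s / 2).re = s.re / 2 := by simp
    have hpi : Real.pi ^ (-s.re / 2) ≤ 1 :=
      Real.rpow_le_one_of_one_le_of_nonpos (by linarith [Real.pi_gt_three]) (by linarith)
    have hΓ : ‖Gamma (s / 2)‖ ≤ Real.exp (2 * (1 + ‖s‖) ^ (3 / 2 : ℝ)) := by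
      refine (norm_Gamma_le_Gamma_re (by linarith)).trans
        ((Gamma_le_rpow_self (by linarith)).trans
          ((rpow_self_le_exp (by linarith)).trans ?_))
      gcongr
      · linarith
      · linarith [re_le_norm s]
    rw [entireXi_eq h0 h1, completedRiemannZeta_eq_Gammaℝ_mul (by linarith), norm_mul,
      norm_mul (Gammaℝ s), norm_Gammaℝ_of_re]
    calc ‖s * (s - 1)‖ * (Real.pi ^ (-s.re / 2) * ‖Gamma (s / 2)‖ * ‖riemannZeta s‖)
        ≤ Real.exp (2 * (1 + ‖s‖) ^ (3 / 2 : ℝ)) *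
          (1 * Real.exp (2 * (1 + ‖s‖) ^ (3 / 2 : ℝ)) * Z) := by
          gcongr
          exacts [hsq s, hZ s hs]
      _ = Z * Real.exp (4 * (1 + ‖s‖) ^ (3 / 2 : ℝ)) := by
          rw [show (4 : ℝ) = 2 + 2 by norm_num, add_mul, Real.exp_add]; ring
  refine ⟨max Z (|B| + 1), fun s => ?_⟩
  have hs0 := norm_nonneg s
  rcases le_total 4 s.re with h | h
  · refine (hright s h).trans ?_
    gcongr
    · exact le_max_left _ _
    · norm_num
  rcases le_total (-3) s.re with h' | h'
  · have he : 1 ≤ Real.exp (2 * (1 + ‖s‖) ^ (3 / 2 : ℝ)) := Real.one_le_exp (by positivity)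
    calc ‖entireXi s‖ ≤ ‖s * (s - 1)‖ * ‖completedRiemannZeta₀ s‖ + 1 := by
          simpa [entireXi] using norm_add_le (s * (s - 1) * completedRiemannZeta₀ s) 1
      _ ≤ Real.exp (2 * (1 + ‖s‖) ^ (3 / 2 : ℝ)) * |B| + Real.exp (2 * (1 + ‖s‖) ^ (3 / 2 : ℝ)) := by
          gcongr
          exacts [hsq s, (hB s h' h).trans (le_abs_self B)]
      _ = (|B| + 1) * Real.exp (2 * (1 + ‖s‖) ^ (3 / 2 : ℝ)) := by ring
      _ ≤ _ := by
          gcongr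
          · exact le_max_right _ _
          · norm_num
  · have h1 : ‖1 - s‖ ≤ 1 + ‖s‖ := by simpa using norm_sub_le 1 s
    have h2 : (1 + ‖1 - s‖) ^ (3 / 2 : ℝ) ≤ 4 * (1 + ‖s‖) ^ (3 / 2 : ℝ) := by
      calc (1 + ‖1 - s‖) ^ (3 / 2 : ℝ) ≤ (2 * (1 + ‖s‖)) ^ (3 / 2 : ℝ) := by gcongr; linarith
        _ = 2 ^ (3 / 2 : ℝ) * (1 + ‖s‖) ^ (3 / 2 : ℝ) :=
          Real.mul_rpow zero_le_two (by linarith)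
        _ ≤ 2 ^ (2 : ℝ) * (1 + ‖s‖) ^ (3 / 2 : ℝ) := by
          gcongr <;> norm_num
        _ = _ := by norm_num
    rw [← entireXi_one_sub]
    refine (hright (1 - s) (by simp; linarith)).trans ?_
    refine mul_le_mul ?_ (Real.exp_le_exp.2 ?_) (Real.exp_nonneg _)
      (hZ0.trans (le_max_left _ _))
    · exact le_max_left _ _
    · linarith only [h2]

/-- The function `entireXi` is not of exponential type. -/
theorem not_norm_entireXi_le_exp (K A : ℝ) : ¬ ∀ s, ‖entireXi s‖ ≤ K * Real.exp (A * ‖s‖) := by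
  intro h
  obtain ⟨c, hc, hζ⟩ := exists_le_norm_riemannZeta (σ := 2) one_lt_two
  have hn : ∀ n : ℕ, c * Real.pi⁻¹ * Real.exp (-2 * A) ≤
      K * ((Real.pi * Real.exp (2 * A)) ^ n / n.factorial) := fun n => by
    set s : ℂ := ((2 * (n + 1) : ℝ) : ℂ) with hs
    have hsre : s.re = 2 * (n + 1) := ofReal_re _
    have hn0 : (0 : ℝ) ≤ n := n.cast_nonneg
    have h0 : s ≠ 0 := fun h => by rw [h] at hsre; simp at hsre; linarith
    have h1 : s ≠ 1 := fun h => by rw [h] at hsre; simp at hsre; linarith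
    have hsn : ‖s‖ = 2 * (n + 1) := by
      rw [hs, norm_real, Real.norm_eq_abs, abs_of_nonneg (by positivity)]
    have hs1 : 1 ≤ ‖s - 1‖ := by
      have := norm_sub_norm_le s 1
      rw [norm_one] at this
      linarith
    have hΓ : ‖Gamma (s / 2)‖ = n.factorial := by
      rw [show s / 2 = n + 1 by rw [hs]; push_cast; ring, Gamma_nat_eq_factorial]
      simp
    have hpi : Real.pi ^ (-s.re / 2) = (Real.pi ^ (n + 1))⁻¹ := by
      rw [hsre, ← Real.rpow_natCast, ← Real.rpow_neg Real.pi_pos.le]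
      congr 1
      push_cast
      ring
    have hle : (Real.pi ^ (n + 1))⁻¹ * n.factorial * c ≤ K * Real.exp (A * ‖s‖) := by
      refine le_trans ?_ (h s)
      rw [entireXi_eq h0 h1, completedRiemannZeta_eq_Gammaℝ_mul (by linarith), norm_mul, norm_mul,
        norm_mul, norm_Gammaℝ_of_re, hΓ, hpi]
      have := hζ s (by linarith)
      have h2 : 1 ≤ ‖s‖ * ‖s - 1‖ := one_le_mul_of_one_le_of_one_le (by linarith) hs1
      refine le_trans ?_ (le_mul_of_one_le_left (by positivity) h2)
      gcongr
    have hexp : Real.exp (A * ‖s‖) = Real.exp (2 * A) ^ n * Real.exp (2 * A) := by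
      rw [← pow_succ, ← Real.exp_nat_mul, hsn]
      congr 1
      push_cast
      ring
    have hpi0 := Real.pi_pos
    rw [hexp] at hle
    rw [neg_mul, Real.exp_neg, mul_pow]
    field_simp at hle ⊢
    convert hle using 1; ring
  have hlim := (FloorSemiring.tendsto_pow_div_factorial_atTop
    (Real.pi * Real.exp (2 * A))).const_mul K
  have := ge_of_tendsto' hlim hn
  have hpos : 0 < c * Real.pi⁻¹ * Real.exp (-2 * A) := by positivity
  linarith

/-- The Riemann zeta function has infinitely many nontrivial zeros. -/
theorem infinite_nontrivial_zeros :
    {s : ℂ | riemannZeta s = 0 ∧ 0 < s.re ∧ s.re < 1}.Infinite := by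
  intro hfin
  obtain ⟨K, hK⟩ := exists_norm_entireXi_le_exp
  obtain ⟨K', A, -, hA⟩ := exists_norm_le_exp_of_finite_zeros (by norm_num) (by norm_num)
    differentiable_entireXi (hfin.subset fun s hs => nontrivial_zero_of_entireXi_eq_zero hs)
    (by norm_num) hK
  exact not_norm_entireXi_le_exp K' A hA

/-- On a vertical line in the right half-plane, a real shift of the argument to the right does not
decrease the order of magnitude of the Gamma function. -/
theorem exists_le_norm_Gamma_add_of_pos {σ a : ℝ} (hσ : 0 < σ) (ha : 0 ≤ a) :
    ∃ c : ℝ, 0 < c ∧ ∀ u : ℂ, u.re = σ → c * ‖Gamma u‖ ≤ ‖Gamma (u + a)‖ := by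
  rcases ha.eq_or_lt with rfl | ha
  · exact ⟨1, one_pos, fun u _ => by simp⟩
  set M := ∫ x : ℝ in (0 : ℝ)..1, x ^ (σ - 1) * (1 - x) ^ (a - 1)
  have hM : 0 ≤ M := intervalIntegral.integral_nonneg zero_le_one fun x hx =>
    mul_nonneg (Real.rpow_nonneg hx.1 _) (Real.rpow_nonneg (sub_nonneg.2 hx.2) _)
  have hΓ := Real.Gamma_pos_of_pos ha
  refine ⟨Real.Gamma a / (M + 1), by positivity, fun u hu => ?_⟩
  have hB : ‖betaIntegral u a‖ ≤ M := by
    refine (intervalIntegral.norm_integral_le_integral_norm zero_le_one).trans_eq ?_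
    simp only [M, intervalIntegral.integral_of_le zero_le_one,
      MeasureTheory.integral_Ioc_eq_integral_Ioo]
    refine MeasureTheory.setIntegral_congr_fun measurableSet_Ioo fun x hx => ?_
    have h1 : (0 : ℝ) < 1 - x := sub_pos.2 hx.2
    simp only [norm_mul]
    rw [← ofReal_one, ← ofReal_sub, norm_cpow_eq_rpow_re_of_pos hx.1,
      norm_cpow_eq_rpow_re_of_pos h1]
    simp [hu]
  have := congrArg norm (Gamma_mul_Gamma_eq_betaIntegral (s := u) (t := a) (by rwa [hu]) (by simpa))
  rw [norm_mul, norm_mul, Gamma_ofReal, norm_real, Real.norm_eq_abs, abs_of_pos hΓ] at this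
  rw [div_mul_eq_mul_div, div_le_iff₀ (by positivity), mul_comm, this]
  gcongr
  linarith

theorem exists_le_norm_Gamma_add (σ : ℝ) {a : ℝ} (ha : 0 ≤ a) :
    ∃ c : ℝ, 0 < c ∧ ∀ u : ℂ, u.re = σ → 1 ≤ |u.im| → c * ‖Gamma u‖ ≤ ‖Gamma (u + a)‖ := by
  obtain ⟨N, hN⟩ := exists_nat_gt (-σ)
  induction N generalizing σ with
  | zero =>
    obtain ⟨c, hc, h⟩ := exists_le_norm_Gamma_add_of_pos (σ := σ) (by simpa using hN) ha
    exact ⟨c, hc, fun u hu _ => h u hu⟩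
  | succ N ih =>
    obtain ⟨c, hc, h⟩ := ih (σ + 1) (by push_cast at hN; linarith)
    refine ⟨c / (1 + a), by positivity, fun u hu him => ?_⟩
    have hu1 : 1 ≤ ‖u‖ := him.trans (abs_im_le_norm u)
    have hua1 : 1 ≤ ‖u + a‖ := him.trans (by simpa using abs_im_le_norm (u + a))
    have hu0 : u ≠ 0 := norm_pos_iff.1 (by linarith)
    have hua0 : u + a ≠ 0 := norm_pos_iff.1 (by linarith)
    have hua : ‖u + a‖ ≤ (1 + a) * ‖u‖ := by
      have := norm_add_le u a
      rw [norm_real, Real.norm_eq_abs, abs_of_nonneg ha] at this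
      nlinarith
    have key := h (u + 1) (by simp [hu]) (by simpa)
    rw [Gamma_add_one u hu0, add_right_comm, Gamma_add_one _ hua0, norm_mul, norm_mul] at key
    have hlt : ‖u‖ * (c * ‖Gamma u‖) ≤ ‖u‖ * ((1 + a) * ‖Gamma (u + a)‖) := by
      calc ‖u‖ * (c * ‖Gamma u‖) = c * (‖u‖ * ‖Gamma u‖) := by ring
        _ ≤ ‖u + a‖ * ‖Gamma (u + a)‖ := key
        _ ≤ (1 + a) * ‖u‖ * ‖Gamma (u + a)‖ := by gcongr
        _ = _ := by ring
    have := le_of_mul_le_mul_left hlt (by linarith)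
    rw [div_mul_eq_mul_div, div_le_iff₀ (by linarith)]
    linarith

theorem norm_Gamma_conj (s : ℂ) : ‖Gamma (starRingEnd ℂ s)‖ = ‖Gamma s‖ := by
  rw [Gamma_conj, norm_conj]

/-- Left of the critical strip, `ζ` grows at least linearly on vertical lines at distance at least
one from the critical line. -/
theorem exists_le_norm_riemannZeta_left {M : ℝ} (hM : 1 ≤ M) :
    ∃ c : ℝ, 0 < c ∧ ∀ s : ℂ, s.re = 1 / 2 - M → 2 ≤ |s.im| → c * |s.im| ≤ ‖riemannZeta s‖ := by
  obtain ⟨c₁, hc₁, hΓ⟩ := exists_le_norm_Gamma_add ((1 / 2 - M) / 2 + 1) (sub_nonneg.2 hM)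
  obtain ⟨c₂, hc₂, hζ⟩ := exists_le_norm_riemannZeta (σ := 1 / 2 + M) (by linarith)
  refine ⟨Real.pi ^ (-M) * (c₁ / 2) * c₂, by positivity, fun s hs him => ?_⟩
  have hs0 : s ≠ 0 := by rintro rfl; norm_num at him
  have hre : (1 - s).re = 1 / 2 + M := by simp [hs]; ring
  set z := starRingEnd ℂ s / 2 with hz
  have hzre : z.re = (1 / 2 - M) / 2 := by simp [hz, hs]
  have hzim : |z.im| = |s.im| / 2 := by simp [hz, abs_div]
  have hz0 : z ≠ 0 := fun h => by simp [h] at hzim; linarith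
  have hΓz : Gamma z ≠ 0 := Gamma_ne_zero fun m h => by simp [h] at hzim; linarith
  have hΓs : ‖Gamma (s / 2)‖ = ‖Gamma z‖ := by rw [← norm_Gamma_conj, map_div₀, map_ofNat]
  have hΓs' : ‖Gamma ((1 - s) / 2)‖ = ‖Gamma (z + 1 + (M - 1 : ℝ))‖ := by
    congr 2
    apply Complex.ext
    · simp [hzre, hs]; ring
    · simp [hz]
  have hpi : Real.pi ^ (-(1 - s).re / 2) = Real.pi ^ (-M) * Real.pi ^ (-s.re / 2) := by
    rw [← Real.rpow_add Real.pi_pos, hre, hs]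
    congr 1
    ring
  have hbound : c₁ * (|s.im| / 2 * ‖Gamma z‖) ≤ ‖Gamma ((1 - s) / 2)‖ := by
    rw [hΓs']
    refine le_trans ?_ (hΓ (z + 1) (by simp [hzre]) (by simp [hzim]; linarith))
    rw [Gamma_add_one z hz0, norm_mul, ← hzim]
    gcongr
    exact abs_im_le_norm z
  have hpos : 0 < Real.pi ^ (-s.re / 2) * ‖Gamma z‖ :=
    mul_pos (Real.rpow_pos_of_pos Real.pi_pos _) (norm_pos_iff.2 hΓz)
  rw [riemannZeta_def_of_ne_zero hs0, ← completedRiemannZeta_one_sub,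
    completedRiemannZeta_eq_Gammaℝ_mul (by linarith), norm_div, norm_mul, norm_Gammaℝ_of_re s,
    norm_Gammaℝ_of_re (1 - s), hpi, hΓs, le_div_iff₀ hpos]
  calc _ = Real.pi ^ (-M) * Real.pi ^ (-s.re / 2) * (c₁ * (|s.im| / 2 * ‖Gamma z‖)) * c₂ := by ring
    _ ≤ _ := by
      gcongr
      exact hζ _ hre.ge

theorem riemannZeta_one_sub_eq_zero {s : ℂ} (h : riemannZeta s = 0) (h0 : 0 < s.re)
    (h1 : s.re < 1) : riemannZeta (1 - s) = 0 := by
  have hs0 : s ≠ 0 := by rintro rfl; simp at h0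
  have hs1 : 1 - s ≠ 0 := sub_ne_zero.2 (by rintro rfl; simp at h1)
  rw [riemannZeta_def_of_ne_zero hs0, div_eq_zero_iff,
    or_iff_left (Gammaℝ_ne_zero_of_re_pos h0)] at h
  rw [riemannZeta_def_of_ne_zero hs1, completedRiemannZeta_one_sub, h, zero_div]

/-- There are nontrivial zeros of arbitrarily large imaginary part. -/
theorem infinite_nontrivial_zeros_of_lt_im (T : ℝ) :
    {s : ℂ | riemannZeta s = 0 ∧ 0 < s.re ∧ s.re < 1 ∧ T < s.im}.Infinite := by
  intro hfin
  have hcompact : ({s : ℂ | s ∈ Set.Icc 0 1 ×ℂ Set.Icc (-|T|) |T|} ∩ riemannZetaZeros).Finite :=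
    (isCompact_Icc.reProdIm isCompact_Icc).inter_riemannZetaZeros_finite
  refine infinite_nontrivial_zeros ((hfin.union (hcompact.union
    (hfin.image fun s => 1 - s))).subset ?_)
  rintro s ⟨hζ, h0, h1⟩
  rcases lt_or_ge T s.im with h | h
  · exact Or.inl ⟨hζ, h0, h1, h⟩
  rcases lt_or_ge T (-s.im) with h' | h'
  · exact Or.inr (Or.inr ⟨1 - s, ⟨riemannZeta_one_sub_eq_zero hζ h0 h1, by simpa, by simpa,
      by simpa⟩, by simp⟩)
  · exact Or.inr (Or.inl ⟨⟨⟨h0.le, h1.le⟩, by linarith [le_abs_self T], h.trans (le_abs_self T)⟩,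
      hζ⟩)

/-- Assuming the Riemann Hypothesis, for any real `M' ≥ 1` and real `x > 0`,
the family `ρ ↦ x^ρ · ζ(ρ − M') / ρ`, indexed by the nontrivial zeros of the
Riemann zeta function with positive imaginary part, is not summable. -/
theorem not_summable_zeta_zero_sum
    (hRH : ∀ ρ : ℂ, riemannZeta ρ = 0 → 0 < ρ.re → ρ.re < 1 → ρ.re = 1 / 2)
    (M' : ℝ) (hM : 1 ≤ M') (x : ℝ) (hx : 0 < x) :
    ¬ Summable (fun ρ : {ρ : ℂ // riemannZeta ρ = 0 ∧ 0 < ρ.re ∧ ρ.re < 1 ∧ 0 < ρ.im} =>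
        (x : ℂ) ^ (ρ : ℂ) * riemannZeta ((ρ : ℂ) - (M' : ℂ)) / (ρ : ℂ)) := by
  intro hsum
  obtain ⟨c, hc, hζ⟩ := exists_le_norm_riemannZeta_left hM
  set δ := x ^ (1 / 2 : ℝ) * c / 2 with hδ
  have hδ0 : 0 < δ := by positivity
  have hev := (hsum.tendsto_cofinite_zero).norm.eventually_lt_const (by simpa using hδ0)
  have hfin := (Filter.eventually_cofinite.1 hev).image Subtype.val
  refine infinite_nontrivial_zeros_of_lt_im 2 (hfin.subset ?_)
  rintro ρ ⟨h0, hre, hre', him⟩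
  refine ⟨⟨ρ, h0, hre, hre', by linarith⟩, not_lt.2 ?_, rfl⟩
  have hhalf := hRH ρ h0 hre hre'
  have him' : |(ρ - M').im| = ρ.im := by simp; linarith
  have hz := hζ (ρ - M') (by simp [hhalf]) (by rw [him']; exact him.le)
  rw [him'] at hz
  have hρ : ‖ρ‖ ≤ 2 * ρ.im := by
    have := norm_le_abs_re_add_abs_im ρ
    rw [hhalf, abs_of_pos (by linarith : 0 < ρ.im)] at this
    norm_num at this
    linarith
  have hρ0 : 0 < ‖ρ‖ := by linarith [abs_im_le_norm ρ, le_abs_self ρ.im]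
  change δ ≤ ‖(x : ℂ) ^ ρ * riemannZeta (ρ - M') / ρ‖
  rw [norm_div, norm_mul, norm_cpow_eq_rpow_re_of_pos hx, hhalf, le_div_iff₀ hρ0]
  calc δ * ‖ρ‖ ≤ δ * (2 * ρ.im) := by gcongr
    _ = x ^ (1 / 2 : ℝ) * (c * ρ.im) := by rw [hδ]; ring
    _ ≤ _ := by gcongr
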